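/- Under assumptions (A1) and (A2), for each pair of class labels 1 ≤ j, i ≤ J and for independent random vectors X ~ F_j^{(d)} and Y ~ F_i^{(d)}, Var(‖X − Y‖²/d) → 0 as d → ∞; consequently ‖X − Y‖²/d − E(‖X − Y‖²/d) converges in probability to 0 as d → ∞. -/

import Mathlib

open MeasureTheory ProbabilityTheory Filter

/-- The covariance of two real-valued functions under a measure. -/
noncomputable def pCov {α : Type*} [MeasurableSpace α] (μ : Measure α) (f g : α → ℝ) : ℝ :=
  (∫ x, f x * g x ∂μ) - (∫ x, f x ∂μ) * (∫ x, g x ∂μ)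

/-- The correlation of two real-valued functions under a measure. -/
noncomputable def pCorr {α : Type*} [MeasurableSpace α] (μ : Measure α) (f g : α → ℝ) : ℝ :=
  pCov μ f g / (Real.sqrt (pCov μ f f) * Real.sqrt (pCov μ g g))

lemma aux_pCov {α : Type*} [MeasurableSpace α] (μ : Measure α) [IsProbabilityMeasure μ]
    (f g : α → ℝ) (hf : MemLp f 2 μ) (hg : MemLp g 2 μ) : pCov μ f g = covariance f g μ := by
  rw [covariance_eq_sub hf hg]; rfl

lemma aux_cov_zero {α : Type*} [MeasurableSpace α] (μ : Measure α) [IsProbabilityMeasure μ]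
    (f g : α → ℝ) (hf : MemLp f 2 μ) (h0 : variance f μ = 0) : covariance f g μ = 0 := by
  refine integral_eq_zero_of_ae ?_
  filter_upwards [ae_eq_integral_of_variance_eq_zero hf h0] with x hx
  simp [hx]

lemma aux_cov_le {α : Type*} [MeasurableSpace α] (μ : Measure α) [IsProbabilityMeasure μ]
    (f g : α → ℝ) (hf : MemLp f 2 μ) (hg : MemLp g 2 μ) (C : ℝ)
    (hfC : variance f μ ≤ C) (hgC : variance g μ ≤ C) :
    covariance f g μ ≤ C * |pCorr μ f g| := by
  have hC : 0 ≤ C := (variance_nonneg f μ).trans hfC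
  by_cases hf0 : variance f μ = 0
  · rw [aux_cov_zero μ f g hf hf0]; positivity
  by_cases hg0 : variance g μ = 0
  · rw [covariance_comm, aux_cov_zero μ g f hg hg0]; positivity
  have hfp : 0 < variance f μ := lt_of_le_of_ne (variance_nonneg f μ) (Ne.symm hf0)
  have hgp : 0 < variance g μ := lt_of_le_of_ne (variance_nonneg g μ) (Ne.symm hg0)
  unfold pCorr
  rw [aux_pCov μ f g hf hg, aux_pCov μ f f hf hf, aux_pCov μ g g hg hg,
    covariance_self hf.aemeasurable, covariance_self hg.aemeasurable, abs_div]
  have h1 : 0 < √(variance f μ) * √(variance g μ) := by positivity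
  rw [abs_of_pos h1, mul_div_assoc', le_div_iff₀ h1]
  have h2 : √(variance f μ) * √(variance g μ) ≤ C := by
    calc _ ≤ √C * √C := by gcongr
      _ = C := Real.mul_self_sqrt hC
  calc _ ≤ |covariance f g μ| * (√(variance f μ) * √(variance g μ)) := by
        gcongr; exact le_abs_self _
    _ ≤ |covariance f g μ| * C := by gcongr
    _ = _ := by ring

lemma aux_var {α : Type*} [MeasurableSpace α] (μ : Measure α) [IsProbabilityMeasure μ] (d : ℕ)
    (f : Fin d → α → ℝ) (hf : ∀ r, MemLp (f r) 2 μ) (C : ℝ)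
    (hfC : ∀ r, variance (f r) μ ≤ C) :
    variance (fun p => (∑ r, f r p) / (d : ℝ)) μ ≤
      C * (1 / (d : ℝ)) + C * ((∑ r, ∑ s, if r ≠ s then |pCorr μ (f r) (f s)| else 0) / (d:ℝ)^2) := by
  have hs : MemLp (fun p => ∑ r, f r p) 2 μ := memLp_finsetSum _ (fun r _ => hf r)
  have h1 : variance (fun p => (∑ r, f r p) / (d : ℝ)) μ
      = (∑ r, ∑ s, covariance (f r) (f s) μ) / (d:ℝ)^2 := by
    have := covariance_fun_sum_fun_sum (μ := μ) hf hf
    rw [← this, covariance_self hs.aemeasurable]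
    simp_rw [div_eq_inv_mul]
    rw [variance_const_mul, inv_pow]
  rw [h1]
  have h2 : ∑ r, ∑ s, covariance (f r) (f s) μ ≤
      ∑ r : Fin d, ∑ s : Fin d, ((if r = s then C else 0) +
        C * (if r ≠ s then |pCorr μ (f r) (f s)| else 0)) := by
    refine Finset.sum_le_sum fun r _ => Finset.sum_le_sum fun s _ => ?_
    by_cases h : r = s
    · subst h
      simpa [covariance_self (hf r).aemeasurable] using hfC r
    · simpa [h] using aux_cov_le μ _ _ (hf r) (hf s) C (hfC r) (hfC s)
  simp only [Finset.sum_add_distrib, ← Finset.mul_sum] at h2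
  simp only [Finset.sum_ite_eq, Finset.mem_univ, if_true, Finset.sum_const, Finset.card_univ,
    Fintype.card_fin, nsmul_eq_mul] at h2
  refine (div_le_div_of_nonneg_right h2 (by positivity)).trans (le_of_eq ?_)
  rcases Nat.eq_zero_or_pos d with rfl | hd
  · simp
  · field_simp

lemma aux_memLp {d : ℕ} (μ ν : Measure (EuclideanSpace ℝ (Fin d))) [IsProbabilityMeasure μ]
    [IsProbabilityMeasure ν] (r : Fin d) (hμ : Integrable (fun x => (x r) ^ 4) μ)
    (hν : Integrable (fun x => (x r) ^ 4) ν) (M : ℝ)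
    (hμM : ∫ x, (x r) ^ 4 ∂μ ≤ M) (hνM : ∫ x, (x r) ^ 4 ∂ν ≤ M) :
    MemLp (fun p : EuclideanSpace ℝ (Fin d) × EuclideanSpace ℝ (Fin d) =>
      (p.1 r - p.2 r) ^ 2) 2 (μ.prod ν) ∧
    variance (fun p : EuclideanSpace ℝ (Fin d) × EuclideanSpace ℝ (Fin d) =>
      (p.1 r - p.2 r) ^ 2) (μ.prod ν) ≤ 16 * M := by
  have hm : Measurable (fun p : EuclideanSpace ℝ (Fin d) × EuclideanSpace ℝ (Fin d) =>
      (p.1 r - p.2 r) ^ 2) := by fun_prop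
  have i1 : Integrable (fun p : EuclideanSpace ℝ (Fin d) × EuclideanSpace ℝ (Fin d) =>
      (p.1 r) ^ 4) (μ.prod ν) := hμ.comp_fst ν
  have i2 : Integrable (fun p : EuclideanSpace ℝ (Fin d) × EuclideanSpace ℝ (Fin d) =>
      (p.2 r) ^ 4) (μ.prod ν) := hν.comp_snd μ
  have i3 := (i1.add i2).const_mul 8
  have hb : ∀ a b : ℝ, ((a - b) ^ 2) ^ 2 ≤ 8 * (a ^ 4 + b ^ 4) := by
    intro a b
    have h1 : (a - b)^2 ≤ 2 * (a^2 + b^2) := by nlinarith [sq_nonneg (a + b)]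
    have h2 : ((a - b) ^ 2) ^ 2 ≤ (2 * (a^2 + b^2)) ^ 2 := by gcongr
    nlinarith [sq_nonneg (a ^ 2 - b ^ 2)]
  have i4 : Integrable (fun p : EuclideanSpace ℝ (Fin d) × EuclideanSpace ℝ (Fin d) =>
      ((p.1 r - p.2 r) ^ 2) ^ 2) (μ.prod ν) := by
    refine i3.mono' (hm.pow_const 2).aestronglyMeasurable (Eventually.of_forall fun p => ?_)
    rw [Real.norm_of_nonneg (by positivity)]
    exact hb _ _
  have hL : MemLp (fun p : EuclideanSpace ℝ (Fin d) × EuclideanSpace ℝ (Fin d) =>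
      (p.1 r - p.2 r) ^ 2) 2 (μ.prod ν) :=
    (memLp_two_iff_integrable_sq hm.aestronglyMeasurable).2 i4
  refine ⟨hL, (variance_le_expectation_sq hm.aestronglyMeasurable).trans ?_⟩
  have e1 : ∫ p, (p.1 r) ^ 4 ∂(μ.prod ν) = ∫ x, (x r) ^ 4 ∂μ := by
    simpa using integral_fun_fst (μ := μ) (ν := ν) (fun x : EuclideanSpace ℝ (Fin d) => (x r) ^ 4)
  have e2 : ∫ p, (p.2 r) ^ 4 ∂(μ.prod ν) = ∫ x, (x r) ^ 4 ∂ν := by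
    simpa using integral_fun_snd (μ := μ) (ν := ν) (fun x : EuclideanSpace ℝ (Fin d) => (x r) ^ 4)
  calc _ ≤ ∫ p, 8 * ((p.1 r) ^ 4 + (p.2 r) ^ 4) ∂(μ.prod ν) :=
        integral_mono i4 i3 (fun p => hb _ _)
    _ = 8 * (∫ x, (x r) ^ 4 ∂μ + ∫ x, (x r) ^ 4 ∂ν) := by
        rw [integral_const_mul, integral_add i1 i2, e1, e2]
    _ ≤ _ := by linarith

/-- Under (A1) and (A2), for independent `X ~ F j d` and `Y ~ F i d` (modelled via the
product measure), `Var(‖X - Y‖²/d) → 0` as `d → ∞`; consequently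
`‖X - Y‖²/d - E(‖X - Y‖²/d)` converges in probability to `0`. -/
theorem mdist_stmt1
    (J : ℕ) (hJ : 2 ≤ J)
    (F : Fin J → (d : ℕ) → Measure (EuclideanSpace ℝ (Fin d)))
    [∀ j d, IsProbabilityMeasure (F j d)]
    -- coordinates have finite fourth moments
    (hmom : ∀ (j : Fin J) (d : ℕ) (q : Fin d), Integrable (fun x => (x q) ^ 4) (F j d))
    -- (A1): uniformly bounded fourth moments
    (M : ℝ)
    (hA1 : ∀ (j : Fin J) (d : ℕ) (q : Fin d), (∫ x, (x q) ^ 4 ∂(F j d)) ≤ M)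
    -- (A2): the sum over pairs r ≠ s of |Corr(U_r², U_s²)| is o(d²)
    (hA2 : ∀ j i : Fin J, Tendsto (fun d : ℕ =>
        (∑ r : Fin d, ∑ s : Fin d, if r ≠ s then
            |pCorr ((F j d).prod (F i d))
              (fun p => (p.1 r - p.2 r) ^ 2) (fun p => (p.1 s - p.2 s) ^ 2)|
          else 0) / (d : ℝ) ^ 2) atTop (nhds 0))
    (j i : Fin J) :
    Tendsto (fun d : ℕ =>
        variance (fun p => ‖p.1 - p.2‖ ^ 2 / (d : ℝ)) ((F j d).prod (F i d)))
      atTop (nhds 0) ∧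
    ∀ ε > (0 : ℝ), Tendsto (fun d : ℕ =>
        ((F j d).prod (F i d))
          {p | ε ≤ |‖p.1 - p.2‖ ^ 2 / (d : ℝ)
                - ∫ p', ‖p'.1 - p'.2‖ ^ 2 / (d : ℝ) ∂((F j d).prod (F i d))|})
      atTop (nhds 0) := by
  have hnorm : ∀ (d : ℕ), (fun p : EuclideanSpace ℝ (Fin d) × EuclideanSpace ℝ (Fin d) =>
      ‖p.1 - p.2‖ ^ 2 / (d : ℝ)) = fun p => (∑ r, (p.1 r - p.2 r) ^ 2) / (d : ℝ) := by
    intro d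
    funext p
    rw [EuclideanSpace.real_norm_sq_eq]
    rfl
  have hk := fun (d : ℕ) (r : Fin d) => aux_memLp (F j d) (F i d) r (hmom j d r) (hmom i d r) M
    (hA1 j d r) (hA1 i d r)
  have hvar : Tendsto (fun d : ℕ =>
        variance (fun p => ‖p.1 - p.2‖ ^ 2 / (d : ℝ)) ((F j d).prod (F i d)))
      atTop (nhds 0) := by
    have hlim := (tendsto_one_div_atTop_nhds_zero_nat (𝕜 := ℝ)).const_mul (16 * M) |>.add
      ((hA2 j i).const_mul (16 * M))
    simp only [mul_zero, add_zero] at hlim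
    refine squeeze_zero (fun d => variance_nonneg _ _) (fun d => ?_) hlim
    rw [hnorm d]
    exact aux_var _ d _ (fun r => (hk d r).1) (16 * M) (fun r => (hk d r).2)
  refine ⟨hvar, fun ε hε => ?_⟩
  have hlim : Tendsto (fun d : ℕ => ENNReal.ofReal
      (variance (fun p => ‖p.1 - p.2‖ ^ 2 / (d : ℝ)) ((F j d).prod (F i d)) / ε ^ 2))
      atTop (nhds 0) := by
    have := ENNReal.tendsto_ofReal (hvar.div_const (ε ^ 2))
    simpa using this
  refine tendsto_of_tendsto_of_tendsto_of_le_of_le tendsto_const_nhds hlim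
    (fun d => zero_le) (fun d => ?_)
  refine meas_ge_le_variance_div_sq ?_ hε
  rw [hnorm d]
  have hs : MemLp (fun p : EuclideanSpace ℝ (Fin d) × EuclideanSpace ℝ (Fin d) =>
      ∑ r, (p.1 r - p.2 r) ^ 2) 2 ((F j d).prod (F i d)) :=
    memLp_finsetSum _ (fun r _ => (hk d r).1)
  simpa only [div_eq_mul_inv] using hs.mul_const _
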